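/- Suppose a Hermitian matrix σ₁ on ℂ^{d_A}⊗ℂ^{d_B} admits a local hidden variable model for all POVMs, and suppose σ₂ = Σ_{i,j} (M_i ⊗ N_j) · σ₁ · (M_i ⊗ N_j)† for finite families of matrices with Σ_i M_i† M_i = I_{d_A} and Σ_j N_j† N_j = I_{d_B}. Then σ₂ also admits a local hidden variable model for all POVMs. -/

import Mathlib

open Matrix Kronecker ComplexOrder

/-- An n-outcome POVM on ℂ^d: positive semidefinite matrices summing to the identity. -/
def IsPOVM {d n : ℕ} (M : Fin n → Matrix (Fin d) (Fin d) ℂ) : Prop :=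
  (∀ i, (M i).PosSemidef) ∧ ∑ i, M i = 1

/-- A local hidden variable model, for all POVMs, of a bipartite operator σ on
ℂ^{d_A}⊗ℂ^{d_B}: a probability space (Hidden, ω) together with, for every local POVM,
response functions valued in [0,1] and summing to 1 over outcomes, whose product
integrated against ω reproduces all joint Born probabilities Tr[σ(A_i ⊗ B_j)]. -/
structure LHVModelPOVM (dA dB : ℕ)
    (σ : Matrix (Fin dA × Fin dB) (Fin dA × Fin dB) ℂ) where
  Hidden : Type
  [mHidden : MeasurableSpace Hidden]
  ω : MeasureTheory.Measure Hidden
  prob : MeasureTheory.IsProbabilityMeasure ω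
  pA : (n : ℕ) → (Fin n → Matrix (Fin dA) (Fin dA) ℂ) → Fin n → Hidden → ℝ
  pB : (n : ℕ) → (Fin n → Matrix (Fin dB) (Fin dB) ℂ) → Fin n → Hidden → ℝ
  pA_mem : ∀ (n : ℕ) (M : Fin n → Matrix (Fin dA) (Fin dA) ℂ), IsPOVM M →
    ∀ i lam, 0 ≤ pA n M i lam ∧ pA n M i lam ≤ 1
  pB_mem : ∀ (n : ℕ) (M : Fin n → Matrix (Fin dB) (Fin dB) ℂ), IsPOVM M →
    ∀ i lam, 0 ≤ pB n M i lam ∧ pB n M i lam ≤ 1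
  pA_sum : ∀ (n : ℕ) (M : Fin n → Matrix (Fin dA) (Fin dA) ℂ), IsPOVM M →
    ∀ lam, ∑ i, pA n M i lam = 1
  pB_sum : ∀ (n : ℕ) (M : Fin n → Matrix (Fin dB) (Fin dB) ℂ), IsPOVM M →
    ∀ lam, ∑ i, pB n M i lam = 1
  born : ∀ (m n : ℕ) (A : Fin m → Matrix (Fin dA) (Fin dA) ℂ)
    (B : Fin n → Matrix (Fin dB) (Fin dB) ℂ), IsPOVM A → IsPOVM B →
    ∀ (i : Fin m) (j : Fin n),
      (σ * (A i ⊗ₖ B j)).trace = ((∫ lam, pA m A i lam * pB n B j lam ∂ω : ℝ) : ℂ)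

/-- Heisenberg-picture pullback of a family of effects. -/
def pullPOVM {d k n : ℕ} (M : Fin k → Matrix (Fin d) (Fin d) ℂ)
    (A : Fin n → Matrix (Fin d) (Fin d) ℂ) : Fin n → Matrix (Fin d) (Fin d) ℂ :=
  fun a => ∑ i, (M i)ᴴ * A a * M i

theorem pullPOVM_isPOVM {d k n : ℕ} (M : Fin k → Matrix (Fin d) (Fin d) ℂ)
    (hM : ∑ i, (M i)ᴴ * M i = 1)
    (A : Fin n → Matrix (Fin d) (Fin d) ℂ) (hA : IsPOVM A) : IsPOVM (pullPOVM M A) := by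
  refine ⟨fun a => ?_, ?_⟩
  · exact Matrix.posSemidef_sum _ fun i _ => (hA.1 a).conjTranspose_mul_mul_same (M i)
  · unfold pullPOVM
    rw [Finset.sum_comm, ← hM]
    refine Finset.sum_congr rfl fun i _ => ?_
    rw [← Finset.sum_mul, ← Finset.mul_sum, hA.2, Matrix.mul_one]

theorem pull_trace {dA dB kA kB : ℕ}
    (σ : Matrix (Fin dA × Fin dB) (Fin dA × Fin dB) ℂ)
    (M : Fin kA → Matrix (Fin dA) (Fin dA) ℂ)
    (N : Fin kB → Matrix (Fin dB) (Fin dB) ℂ)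
    (X : Matrix (Fin dA) (Fin dA) ℂ) (Y : Matrix (Fin dB) (Fin dB) ℂ) :
    ((∑ i, ∑ j, (M i ⊗ₖ N j) * σ * (M i ⊗ₖ N j)ᴴ) * (X ⊗ₖ Y)).trace =
      (σ * ((∑ i, (M i)ᴴ * X * M i) ⊗ₖ (∑ j, (N j)ᴴ * Y * N j))).trace := by
  have h : ((∑ i, (M i)ᴴ * X * M i) ⊗ₖ (∑ j, (N j)ᴴ * Y * N j)) =
      ∑ i, ∑ j, (M i ⊗ₖ N j)ᴴ * (X ⊗ₖ Y) * (M i ⊗ₖ N j) := by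
    simp only [Matrix.conjTranspose_kronecker, ← Matrix.mul_kronecker_mul]
    ext a b
    simp only [Matrix.kroneckerMap_apply, Matrix.sum_apply, Finset.sum_mul_sum]
  rw [h]
  simp only [Finset.sum_mul, Finset.mul_sum, Matrix.trace_sum]
  refine Finset.sum_congr rfl fun i _ => Finset.sum_congr rfl fun j _ => ?_
  rw [Matrix.mul_assoc, Matrix.mul_assoc, Matrix.trace_mul_comm]
  simp only [Matrix.mul_assoc]

/-- local hidden variable models (for all POVMs) are preserved under local
quantum operations: if σ₁ admits an LHV model and
σ₂ = Σ_{i,j} (M_i ⊗ N_j) σ₁ (M_i ⊗ N_j)† with Σ_i M_i†M_i = I and Σ_j N_j†N_j = I,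
then σ₂ also admits an LHV model. -/
theorem stmt18 {dA dB kA kB : ℕ}
    (σ₁ σ₂ : Matrix (Fin dA × Fin dB) (Fin dA × Fin dB) ℂ)
    (hHerm : σ₁.IsHermitian)
    (hLHV : Nonempty (LHVModelPOVM dA dB σ₁))
    (M : Fin kA → Matrix (Fin dA) (Fin dA) ℂ)
    (N : Fin kB → Matrix (Fin dB) (Fin dB) ℂ)
    (hM : ∑ i, (M i)ᴴ * M i = 1) (hN : ∑ j, (N j)ᴴ * N j = 1)
    (hσ₂ : σ₂ = ∑ i, ∑ j, (M i ⊗ₖ N j) * σ₁ * (M i ⊗ₖ N j)ᴴ) :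
    Nonempty (LHVModelPOVM dA dB σ₂) := by
  obtain ⟨L⟩ := hLHV
  letI := L.mHidden
  exact ⟨{ Hidden := L.Hidden
           mHidden := L.mHidden
           ω := L.ω
           prob := L.prob
           pA := fun n A => L.pA n (pullPOVM M A)
           pB := fun n B => L.pB n (pullPOVM N B)
           pA_mem := fun n A hA => L.pA_mem n _ (pullPOVM_isPOVM M hM A hA)
           pB_mem := fun n B hB => L.pB_mem n _ (pullPOVM_isPOVM N hN B hB)
           pA_sum := fun n A hA => L.pA_sum n _ (pullPOVM_isPOVM M hM A hA)
           pB_sum := fun n B hB => L.pB_sum n _ (pullPOVM_isPOVM N hN B hB)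
           born := fun m n A B hA hB i j => by
             rw [hσ₂, pull_trace]
             exact L.born m n _ _ (pullPOVM_isPOVM M hM A hA)
               (pullPOVM_isPOVM N hN B hB) i j }⟩
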